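/- (Goryushkin) Every countable group G can be embedded into a 2-generated simple group: there exists a simple group S generated by some 2 elements, together with an injective group homomorphism φ : G → S. -/

import Mathlib

open Equiv
open scoped commutatorElement

/-- The permutation of `I × F` acting on the fibre over `i` by `f i`. -/
def fiberwise (I F : Type*) : (I → Perm F) →* Perm (I × F) where
  toFun f := prodCongrRight f
  map_one' := rfl
  map_mul' _ _ := rfl

/-- The permutation of `I × F` acting on the slice `I × {ω}` by `h ω`. -/
def slicewise (I F : Type*) : (F → Perm I) →* Perm (I × F) where
  toFun h := prodCongrLeft h
  map_one' := rfl
  map_mul' _ _ := rfl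

/-- The permutation of `I × F` induced by a permutation of `I`. -/
def onBase (I F : Type*) : Perm I →* Perm (I × F) :=
  (slicewise I F).comp (Pi.constMonoidHom F (Perm I))

/-- The permutation of `I × F` acting by a permutation of `F` on the fibre over `i`. -/
def onFiber {I : Type*} (F : Type*) [DecidableEq I] (i : I) : Perm F →* Perm (I × F) :=
  (fiberwise I F).comp (MonoidHom.mulSingle (fun _ : I => Perm F) i)

section

variable {I F : Type*}

@[simp] lemma fiberwise_apply (f : I → Perm F) (x : I × F) :
    fiberwise I F f x = (x.1, f x.1 x.2) := rfl

@[simp] lemma slicewise_apply (h : F → Perm I) (x : I × F) :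
    slicewise I F h x = (h x.2 x.1, x.2) := rfl

@[simp] lemma onBase_apply (p : Perm I) (x : I × F) : onBase I F p x = (p x.1, x.2) := rfl

lemma onFiber_apply [DecidableEq I] (i : I) (p : Perm F) (x : I × F) :
    onFiber F i p x = (x.1, if x.1 = i then p x.2 else x.2) := by
  by_cases h : x.1 = i
  · simp [onFiber, h]
  · simp [onFiber, h]

lemma onBase_mul_fiberwise (p : Perm I) (f : I → Perm F) :
    onBase I F p * fiberwise I F f = fiberwise I F (f ∘ p.symm) * onBase I F p := by
  ext x <;> simp

lemma onBase_mul_onFiber [DecidableEq I] (p : Perm I) (i : I) (x : Perm F) :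
    onBase I F p * onFiber F i x = onFiber F (p i) x * onBase I F p := by
  ext y <;> simp [onFiber_apply]

lemma conj_eq_conj_of_eqOn_support {X : Type*} {h k g : Perm X}
    (H : ∀ x, g x ≠ x → h x = k x) : h * g * h⁻¹ = k * g * k⁻¹ := by
  have hd : Perm.Disjoint (k⁻¹ * h) g := by
    intro x
    by_cases hx : g x = x
    · exact Or.inr hx
    · left
      simp [Perm.mul_apply, H x hx]
  have hc := hd.commute.eq
  rw [mul_assoc, inv_mul_eq_iff_eq_mul] at hc
  rw [mul_inv_eq_iff_eq_mul, hc]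
  group

lemma onFiber_injective [DecidableEq I] (i : I) : Function.Injective (onFiber F i) := by
  intro x y h
  ext ω
  simpa [onFiber_apply] using congr_arg Prod.snd (congr_fun (congr_arg DFunLike.coe h) (i, ω))

end

section

variable {Ω : Type} (σ a τ : Perm Ω) (S : Set Ω)

open Classical in
/-- The permutation exchanging `{i} × S` and `{j} × S`. -/
noncomputable def swapOn (S : Set Ω) (i j : Fin 15) : Perm (Fin 15 × Ω) :=
  slicewise (Fin 15) Ω fun ω => if ω ∈ S then swap i j else 1

lemma swapOn_apply_of_mem {S : Set Ω} {ω : Ω} (h : ω ∈ S) (i j y : Fin 15) :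
    swapOn S i j (y, ω) = (swap i j y, ω) := by simp [swapOn, h]

lemma swapOn_apply_of_notMem {S : Set Ω} {ω : Ω} (h : ω ∉ S) (i j y : Fin 15) :
    swapOn S i j (y, ω) = (y, ω) := by simp [swapOn, h]

open Classical in
lemma swapOn_apply (S : Set Ω) (i j y : Fin 15) (ω : Ω) :
    swapOn S i j (y, ω) = (if ω ∈ S then swap i j y else y, ω) := by
  by_cases h : ω ∈ S <;> simp [swapOn, h]

/-- The fibre coordinates of the first generator. -/
def pattern : Fin 15 → Perm Ω := ![σ, 1, a, σ⁻¹, 1, 1, τ, τ, 1, 1, 1, 1, 1, 1, a⁻¹]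

/-- The first generator. -/
noncomputable def genU : Perm (Fin 15 × Ω) :=
  fiberwise (Fin 15) Ω (pattern σ a τ) * swapOn S 10 11

/-- The second generator, translating the index `Fin 15`. -/
def genV (Ω : Type) : Perm (Fin 15 × Ω) := onBase (Fin 15) Ω (Equiv.addRight 1)

/-- The subgroup generated by the two generators. -/
noncomputable def genH : Subgroup (Perm (Fin 15 × Ω)) :=
  Subgroup.closure {genU σ a τ S, genV Ω}

lemma genU_mem : genU σ a τ S ∈ genH σ a τ S := Subgroup.subset_closure (by simp)

lemma genV_mem : genV Ω ∈ genH σ a τ S := Subgroup.subset_closure (by simp)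

lemma closure_genU_genV :
    Subgroup.closure {(⟨genU σ a τ S, genU_mem σ a τ S⟩ : genH σ a τ S),
      ⟨genV Ω, genV_mem σ a τ S⟩} = ⊤ := by
  refine Eq.trans (congr_arg _ ?_)
    (Subgroup.closure_closure_coe_preimage (k := {genU σ a τ S, genV Ω}))
  ext x
  exact or_congr Subtype.ext_iff Subtype.ext_iff

lemma onBase_addRight_mem (k : Fin 15) :
    onBase (Fin 15) Ω (Equiv.addRight k) ∈ genH σ a τ S := by
  have h : Equiv.addRight k = (Equiv.addRight (1 : Fin 15)) ^ (k : ℕ) := by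
    revert k; decide
  rw [h, map_pow]
  exact pow_mem (genV_mem σ a τ S) _

/-- The conjugate of the first generator by the translation by `-k`. -/
noncomputable def shiftU (k : Fin 15) : Perm (Fin 15 × Ω) :=
  fiberwise (Fin 15) Ω (fun y => pattern σ a τ (y + k)) * swapOn S (10 - k) (11 - k)

lemma shiftU_mem (k : Fin 15) : shiftU σ a τ S k ∈ genH σ a τ S := by
  have h : shiftU σ a τ S k = (onBase (Fin 15) Ω (Equiv.addRight k))⁻¹ * genU σ a τ S *
      onBase (Fin 15) Ω (Equiv.addRight k) := by
    rw [eq_comm, mul_assoc, inv_mul_eq_iff_eq_mul, genU, shiftU]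
    have key : ∀ y k : Fin 15, swap 10 11 (y + k) = swap (10 - k) (11 - k) y + k := by decide
    ext ⟨y, ω⟩
    all_goals
      by_cases h : ω ∈ S <;> simp [swapOn, h, key]
  have hk := onBase_addRight_mem σ a τ S k
  rw [h]
  exact mul_mem (mul_mem (inv_mem hk) (genU_mem σ a τ S)) hk

lemma shiftU_apply_of_ne {k y : Fin 15} (h₁ : y ≠ 10 - k) (h₂ : y ≠ 11 - k) (ω : Ω) :
    shiftU σ a τ S k (y, ω) = (y, pattern σ a τ (y + k) ω) := by
  by_cases h : ω ∈ S <;>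
    simp [shiftU, swapOn_apply_of_mem, swapOn_apply_of_notMem, h, swap_apply_of_ne_of_ne h₁ h₂]

/-- The permutations of the fibre whose action on the fibre over `0` lies in `genH`. -/
noncomputable def fiberH : Subgroup (Perm Ω) := (genH σ a τ S).comap (onFiber Ω 0)

lemma conj_mem_fiberH {k : Fin 15} (h₁ : (0 : Fin 15) ≠ 10 - k) (h₂ : (0 : Fin 15) ≠ 11 - k)
    {x : Perm Ω} (hx : x ∈ fiberH σ a τ S) :
    pattern σ a τ k * x * (pattern σ a τ k)⁻¹ ∈ fiberH σ a τ S := by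
  have h : onFiber Ω (0 : Fin 15) (pattern σ a τ k * x * (pattern σ a τ k)⁻¹) =
      shiftU σ a τ S k * onFiber Ω 0 x * (shiftU σ a τ S k)⁻¹ := by
    rw [map_mul, map_mul, map_inv]
    apply conj_eq_conj_of_eqOn_support
    rintro ⟨y, ω⟩ hy
    obtain rfl : y = 0 := by
      by_contra h
      simp [onFiber_apply, h] at hy
    rw [shiftU_apply_of_ne _ _ _ _ h₁ h₂]
    simp [onFiber_apply]
  have hk := shiftU_mem σ a τ S k
  rw [fiberH, Subgroup.mem_comap, h]
  exact mul_mem (mul_mem hk hx) (inv_mem hk)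

lemma comm_mem_fiberH : σ * a * σ⁻¹ * a⁻¹ ∈ fiberH σ a τ S := by
  have h : onFiber Ω (0 : Fin 15) (σ * a * σ⁻¹ * a⁻¹) =
      shiftU σ a τ S 0 * shiftU σ a τ S 2 * (shiftU σ a τ S 0)⁻¹ * (shiftU σ a τ S 2)⁻¹ := by
    rw [eq_mul_inv_iff_mul_eq, eq_mul_inv_iff_mul_eq]
    ext1 ⟨y, ω⟩
    by_cases hS : ω ∈ S <;> fin_cases y <;>
      simp [-map_mul, -map_inv, shiftU, swapOn_apply, onFiber_apply, pattern, swap_apply_def, hS]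
  have h0 := shiftU_mem σ a τ S 0
  have h2 := shiftU_mem σ a τ S 2
  rw [fiberH, Subgroup.mem_comap, h]
  exact mul_mem (mul_mem (mul_mem h0 h2) (inv_mem h0)) (inv_mem h2)

lemma conj_pow_mem_fiberH (i : ℕ) : σ ^ i * a * (σ ^ i)⁻¹ * a⁻¹ ∈ fiberH σ a τ S := by
  induction i with
  | zero => simp
  | succ i ih =>
    have h : σ ^ (i + 1) * a * (σ ^ (i + 1))⁻¹ * a⁻¹ =
        σ * (σ ^ i * a * (σ ^ i)⁻¹ * a⁻¹) * σ⁻¹ * (σ * a * σ⁻¹ * a⁻¹) := by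
      rw [pow_succ']; group
    rw [h]
    exact mul_mem (conj_mem_fiberH σ a τ S (k := 0) (by decide) (by decide) ih)
      (comm_mem_fiberH σ a τ S)

lemma commutator_conj_pow_mem_fiberH (i j : ℕ) :
    ⁅σ ^ i * a * (σ ^ i)⁻¹, σ ^ j * a * (σ ^ j)⁻¹⁆ ∈ fiberH σ a τ S := by
  have hi := conj_pow_mem_fiberH σ a τ S i
  have hj := conj_pow_mem_fiberH σ a τ S j
  have h : ⁅σ ^ i * a * (σ ^ i)⁻¹, σ ^ j * a * (σ ^ j)⁻¹⁆ =
      (σ ^ i * a * (σ ^ i)⁻¹ * a⁻¹) *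
        (a * ((σ ^ j * a * (σ ^ j)⁻¹ * a⁻¹) * (σ ^ i * a * (σ ^ i)⁻¹ * a⁻¹)⁻¹) * a⁻¹) *
        (σ ^ j * a * (σ ^ j)⁻¹ * a⁻¹)⁻¹ := by
    rw [commutatorElement_def]; group
  rw [h]
  exact mul_mem (mul_mem hi (conj_mem_fiberH σ a τ S (k := 2) (by decide) (by decide)
    (mul_mem hj (inv_mem hi)))) (inv_mem hj)

lemma mem_top_of_swap_mem (M : Subgroup (Perm (Fin 15))) (h01 : swap 0 1 ∈ M)
    (hM : ∀ m ∈ M, Equiv.addRight 1 * m * (Equiv.addRight 1)⁻¹ ∈ M) : M = ⊤ := by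
  have h : ∀ i : Fin 14, swap i.castSucc i.succ ∈ M := by
    intro i
    induction i using Fin.induction with
    | zero => exact h01
    | succ i ih =>
      have := hM _ ih
      rw [← swap_apply_apply] at this
      convert this using 2 <;> clear * - <;> revert i <;> decide
  rw [eq_top_iff, ← Subgroup.toSubmonoid_le, Subgroup.top_toSubmonoid,
    ← Perm.mclosure_swap_castSucc_succ, Submonoid.closure_le]
  rintro _ ⟨i, rfl⟩
  exact h i

variable {σ a τ S} {N : Subgroup (Perm (Fin 15 × Ω))}

lemma swapOn_mem (hN : ∀ h ∈ genH σ a τ S, ∀ n ∈ N, h * n * h⁻¹ ∈ N)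
    {s : Perm Ω} (hs : ∀ ω, s (s ω) = ω) (hS : ∀ ω ∈ S, s ω ∉ S)
    (hS' : ∀ ω ∉ S, s ω ∉ S → s ω = ω) (hsN : onFiber Ω 0 s ∈ N) : swapOn S 0 1 ∈ N := by
  have h := hN _ (shiftU_mem σ a τ S 10) _ hsN
  rw [conj_eq_conj_of_eqOn_support (k := swapOn S 0 1)] at h
  · have key : swapOn S 0 1 = onFiber Ω 0 s *
        (swapOn S 0 1 * onFiber Ω 0 s * (swapOn S 0 1)⁻¹) * onFiber Ω 0 s := by
      have hq : (swapOn S 0 1)⁻¹ = swapOn S 0 1 := by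
        rw [inv_eq_iff_mul_eq_one]
        ext1 ⟨y, ω⟩
        by_cases h : ω ∈ S <;> simp [swapOn_apply, h]
      rw [hq]
      ext1 ⟨y, ω⟩
      have h1 := hs ω
      have h2 := hS ω
      have h3 := hS' ω
      by_cases h4 : ω ∈ S <;> by_cases h5 : s ω ∈ S <;> by_cases h6 : y = 0 <;>
        by_cases h7 : y = 1 <;>
        simp_all [swapOn_apply, onFiber_apply, swap_apply_def]
    rw [key]
    exact mul_mem (mul_mem hsN h) hsN
  · rintro ⟨y, ω⟩ hy
    obtain rfl : y = 0 := by
      by_contra h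
      simp [onFiber_apply, h] at hy
    simp [shiftU, swapOn_apply, pattern]
    by_cases hS : ω ∈ S <;> simp [hS]

lemma onBase_swap_mem (hN : ∀ h ∈ genH σ a τ S, ∀ n ∈ N, h * n * h⁻¹ ∈ N)
    (hτ : ∀ ω, τ ω ∈ S ↔ ω ∉ S) (h : swapOn S 0 1 ∈ N) :
    onBase (Fin 15) Ω (swap 0 1) ∈ N := by
  have h' := hN _ (shiftU_mem σ a τ S 6) _ h
  rw [conj_eq_conj_of_eqOn_support (k := fiberwise (Fin 15) Ω fun _ => τ)] at h'
  · have key : onBase (Fin 15) Ω (swap 0 1) = swapOn S 0 1 *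
        (fiberwise (Fin 15) Ω (fun _ => τ) * swapOn S 0 1 *
          (fiberwise (Fin 15) Ω (fun _ => τ))⁻¹) := by
      rw [← mul_assoc, ← mul_assoc, eq_mul_inv_iff_mul_eq]
      ext1 ⟨y, ω⟩
      have h1 := hτ ω
      by_cases h4 : ω ∈ S <;> simp_all [swapOn_apply]
    rw [key]
    exact mul_mem h h'
  · rintro ⟨y, ω⟩ hy
    have : y = 0 ∨ y = 1 := by
      by_contra! h
      simp [swapOn_apply, swap_apply_of_ne_of_ne h.1 h.2] at hy
    rcases this with rfl | rfl
    · rw [shiftU_apply_of_ne _ _ _ _ (by decide) (by decide)]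
      simp [pattern]
    · rw [shiftU_apply_of_ne _ _ _ _ (by decide) (by decide)]
      simp [pattern]

lemma onBase_mem (hN : ∀ h ∈ genH σ a τ S, ∀ n ∈ N, h * n * h⁻¹ ∈ N)
    (h : onBase (Fin 15) Ω (swap 0 1) ∈ N) (p : Perm (Fin 15)) :
    onBase (Fin 15) Ω p ∈ N := by
  have := mem_top_of_swap_mem (N.comap (onBase (Fin 15) Ω)) h fun m hm => by
    have := hN _ (genV_mem σ a τ S) _ hm
    rwa [genV, ← map_inv, ← map_mul, ← map_mul] at this
  rw [← Subgroup.mem_comap, this]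
  exact Subgroup.mem_top p

lemma swapOn_ten_mem (hN : ∀ h ∈ genH σ a τ S, ∀ n ∈ N, h * n * h⁻¹ ∈ N)
    (h : swapOn S 0 1 ∈ N) : swapOn S 10 11 ∈ N := by
  have h' := hN _ (onBase_addRight_mem σ a τ S 10) _ h
  have key : swapOn S 10 11 = onBase (Fin 15) Ω (Equiv.addRight 10) * swapOn S 0 1 *
      (onBase (Fin 15) Ω (Equiv.addRight 10))⁻¹ := by
    rw [eq_mul_inv_iff_mul_eq]
    ext1 ⟨y, ω⟩
    have : ∀ y : Fin 15, swap 10 11 (y + 10) = swap 0 1 y + 10 := by decide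
    by_cases hS : ω ∈ S <;> simp [swapOn_apply, hS, this]
  rwa [key]

lemma fiberwise_pattern_mem (hN : ∀ h ∈ genH σ a τ S, ∀ n ∈ N, h * n * h⁻¹ ∈ N)
    (hτ : τ * τ = 1) (hb : ∀ p, onBase (Fin 15) Ω p ∈ N)
    (h : swapOn S 10 11 ∈ N) : fiberwise (Fin 15) Ω (pattern σ a τ) ∈ N := by
  set t := fiberwise (Fin 15) Ω (pattern σ a τ) with ht
  have htN : ∀ n ∈ N, t * n * t⁻¹ ∈ N := by
    intro n hn
    have e : t * n * t⁻¹ = genU σ a τ S * ((swapOn S 10 11)⁻¹ * n * swapOn S 10 11) *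
        (genU σ a τ S)⁻¹ := by
      rw [genU, ← ht]; group
    rw [e]
    exact hN _ (genU_mem σ a τ S) _ (mul_mem (mul_mem (inv_mem h) hn) h)
  have key : ∀ p : Perm (Fin 15),
      ∃ n ∈ N, fiberwise (Fin 15) Ω (pattern σ a τ ∘ p) = n * t := by
    intro p
    refine ⟨onBase _ _ p.symm * (t * (onBase _ _ p.symm)⁻¹ * t⁻¹),
      mul_mem (hb _) (htN _ (inv_mem (hb _))), ?_⟩
    have := onBase_mul_fiberwise (F := Ω) p.symm (pattern σ a τ)
    rw [← mul_inv_eq_iff_eq_mul, ← ht] at this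
    rw [symm_symm] at this
    rw [← this]
    group
  obtain ⟨n₁, hn₁, e₁⟩ := key (swap 3 4 * swap 14 5 * swap 7 1)
  obtain ⟨n₂, hn₂, e₂⟩ := key (swap 0 4 * swap 2 5 * swap 6 1)
  have e : t = n₁ * t * (n₂ * t) := by
    rw [← e₁, ← e₂, ← map_mul, ht]
    congr 1
    funext y
    fin_cases y <;> simp [pattern, swap_apply_def, hτ]
  have e' : t = (n₁ * (t * n₂ * t⁻¹))⁻¹ := by
    rw [eq_comm, inv_eq_iff_mul_eq_one, ← mul_right_cancel_iff (a := t)]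
    nth_rw 5 [e]
    group
  rw [e']
  exact inv_mem (mul_mem hn₁ (htN _ hn₂))

theorem genH_le (hN : ∀ h ∈ genH σ a τ S, ∀ n ∈ N, h * n * h⁻¹ ∈ N)
    (hτ : τ * τ = 1) (hτS : ∀ ω, τ ω ∈ S ↔ ω ∉ S) {s : Perm Ω}
    (hs : ∀ ω, s (s ω) = ω) (hS : ∀ ω ∈ S, s ω ∉ S)
    (hS' : ∀ ω ∉ S, s ω ∉ S → s ω = ω) (hsN : onFiber Ω 0 s ∈ N) : genH σ a τ S ≤ N := by
  have hq := swapOn_mem hN hs hS hS' hsN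
  have hb := onBase_mem hN (onBase_swap_mem hN hτS hq)
  have hq' := swapOn_ten_mem hN hq
  rw [genH, Subgroup.closure_le]
  rintro x (rfl | rfl)
  · exact mul_mem (fiberwise_pattern_mem hN hτ hb hq') hq'
  · exact hb _

end

lemma three_pow_add_eq {p q r s : ℕ} (h : 3 ^ p + 3 ^ q = 3 ^ r + 3 ^ s) :
    (p = r ∧ q = s) ∨ (p = s ∧ q = r) := by
  have lt_of_le : ∀ {p q r s : ℕ}, p ≤ q → 3 ^ p + 3 ^ q = 3 ^ r + 3 ^ s → s ≤ q := by
    intro p q r s hpq h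
    by_contra! hlt
    have h1 : 3 ^ (q + 1) ≤ 3 ^ s := Nat.pow_le_pow_right (by norm_num) hlt
    have h2 : 3 ^ p ≤ 3 ^ q := Nat.pow_le_pow_right (by norm_num) hpq
    have h3 : 0 < 3 ^ r := by positivity
    rw [pow_succ] at h1
    omega
  wlog hpq : p ≤ q generalizing p q
  · have := this (p := q) (q := p) (by omega) (by omega)
    tauto
  wlog hrs : r ≤ s generalizing r s
  · have := this (r := s) (s := r) (by omega) (by omega)
    tauto
  obtain rfl : q = s := le_antisymm (lt_of_le hrs h.symm) (lt_of_le hpq h)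
  exact Or.inl ⟨by simpa using h, rfl⟩

section

variable {D : Type}

/-- The permutation of `ℤ × D` lowering the first coordinate. -/
def lower (D : Type) : Perm (ℤ × D) := onBase ℤ D (Equiv.addRight (-1))

/-- The function placing `a m` at the position `3 ^ m`. -/
noncomputable def sparse (a : ℕ → Perm D) : ℤ → Perm D :=
  Function.extend (fun m : ℕ => (3 : ℤ) ^ m) a 1

lemma sparse_pow (a : ℕ → Perm D) (m : ℕ) : sparse a (3 ^ m) = a m :=
  (Int.pow_right_injective (a := 3) (by decide)).extend_apply a 1 m

lemma lower_conj (f : ℤ → Perm D) (i : ℕ) :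
    lower D ^ i * fiberwise ℤ D f * (lower D ^ i)⁻¹ = fiberwise ℤ D fun k => f (k + i) := by
  have h : lower D ^ i = onBase ℤ D (Equiv.addRight (-(i : ℤ))) := by
    rw [lower, ← map_pow]
    congr 1
    ext
    simp
  rw [h, onBase_mul_fiberwise, mul_inv_cancel_right]
  congr 1
  ext1 k
  simp

lemma commutator_sparse (a : ℕ → Perm D) (m n : ℕ) :
    ⁅fun k => sparse a (k + 3 ^ m), fun k => sparse a (k + 3 ^ n)⁆ =
      Pi.mulSingle (M := fun _ : ℤ => Perm D) 0 ⁅a m, a n⁆ := by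
  ext1 k
  rcases eq_or_ne m n with rfl | hmn
  · simp
  rw [commutatorElement_def]
  rcases eq_or_ne k 0 with rfl | hk
  · simp [commutatorElement_def, sparse_pow]
  rw [Pi.mulSingle_eq_of_ne hk]
  have : sparse a (k + 3 ^ m) = 1 ∨ sparse a (k + 3 ^ n) = 1 := by
    by_contra! h
    obtain ⟨p, hp⟩ : ∃ p : ℕ, (3 : ℤ) ^ p = k + 3 ^ m := by
      by_contra hp
      exact h.1 (Function.extend_apply' _ _ _ hp)
    obtain ⟨q, hq⟩ : ∃ p : ℕ, (3 : ℤ) ^ p = k + 3 ^ n := by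
      by_contra hp
      exact h.2 (Function.extend_apply' _ _ _ hp)
    have e : (3 : ℤ) ^ p + 3 ^ n = 3 ^ q + 3 ^ m := by linarith
    rcases three_pow_add_eq (by exact_mod_cast e) with ⟨_, h2⟩ | ⟨rfl, _⟩
    · exact hmn h2.symm
    · exact hk (by linarith)
  rcases this with h | h <;> simp [h]

lemma onFiber_commutator_mem_fiberH (a : ℕ → Perm D) (τ : Perm (ℤ × D)) (S : Set (ℤ × D))
    (m n : ℕ) :
    onFiber D (0 : ℤ) ⁅a m, a n⁆ ∈ fiberH (lower D) (fiberwise ℤ D (sparse a)) τ S := by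
  have h := commutator_conj_pow_mem_fiberH (lower D) (fiberwise ℤ D (sparse a)) τ S
    (3 ^ m) (3 ^ n)
  rw [lower_conj, lower_conj, ← map_commutatorElement] at h
  push_cast at h
  rwa [commutator_sparse] at h

end

lemma exists_involution_exchanging_compl {Ω : Type} [Countable Ω] {S : Set Ω}
    (h₁ : S.Infinite) (h₂ : Sᶜ.Infinite) :
    ∃ τ : Perm Ω, τ * τ = 1 ∧ ∀ ω, τ ω ∈ S ↔ ω ∉ S := by
  classical
  have := h₁.to_subtype
  have := h₂.to_subtype
  obtain ⟨e⟩ : Nonempty (S ≃ (Sᶜ : Set Ω)) := nonempty_equiv_of_countable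
  let f : Ω → Ω := fun ω => if h : ω ∈ S then e ⟨ω, h⟩ else e.symm ⟨ω, h⟩
  have hf : ∀ ω, f ω ∈ S ↔ ω ∉ S := by
    intro ω
    by_cases h : ω ∈ S
    · simp only [f, h, dite_true, not_true_eq_false, iff_false]
      exact (e ⟨ω, h⟩).2
    · simp [f, h]
  have hff : Function.Involutive f := by
    intro ω
    by_cases h : ω ∈ S
    · have h' : f ω ∉ S := by simpa [h] using hf ω
      rw [show f (f ω) = e.symm ⟨f ω, h'⟩ from dif_neg h']
      simp [f, h]
    · have h' : f ω ∈ S := by simpa [h] using hf ω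
      rw [show f (f ω) = e ⟨f ω, h'⟩ from dif_pos h']
      simp [f, h]
  refine ⟨hff.toPerm, ?_, hf⟩
  ext ω
  exact hff ω

theorem exists_simple_quotient {H G : Type} [Group H] [Group G] [Nontrivial G] {φ : G →* H}
    (hφ : ∀ N : Subgroup H, N.Normal → ∀ g, g ≠ 1 → φ g ∈ N → N = ⊤)
    (hinj : Function.Injective φ) :
    ∃ M : Subgroup H, ∃ _ : M.Normal, IsSimpleGroup (H ⧸ M) ∧
      Function.Injective ((QuotientGroup.mk' M).comp φ) := by
  obtain ⟨g₀, hg₀⟩ := exists_ne (1 : G)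
  obtain ⟨M, hM⟩ : ∃ M, Maximal (· ∈ {M : Subgroup H | M.Normal ∧ φ g₀ ∉ M}) M := by
    refine zorn_le₀ _ fun c hc hchain => ?_
    rcases c.eq_empty_or_nonempty with rfl | hne
    · exact ⟨⊥, ⟨inferInstance, by simpa using fun h => hg₀ ((map_eq_one_iff φ hinj).1 h)⟩,
        by simp⟩
    have hmem : ∀ x, x ∈ sSup c ↔ ∃ s ∈ c, x ∈ s := fun x =>
      Subgroup.mem_sSup_of_directedOn hne hchain.directedOn
    refine ⟨sSup c, ⟨⟨fun n hn g => ?_⟩, fun h => ?_⟩, fun z hz => le_sSup hz⟩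
    · obtain ⟨s, hs, hns⟩ := (hmem n).1 hn
      exact (hmem _).2 ⟨s, hs, (hc hs).1.conj_mem n hns g⟩
    · obtain ⟨s, hs, hns⟩ := (hmem _).1 h
      exact (hc hs).2 hns
  have hMn := hM.prop.1
  have hMg := hM.prop.2
  have : Nontrivial (H ⧸ M) :=
    ⟨φ g₀, 1, fun h => hMg ((QuotientGroup.eq_one_iff _).1 h)⟩
  refine ⟨M, hMn, ⟨?_⟩, ?_⟩
  · intro L hL
    by_cases h : φ g₀ ∈ L.comap (QuotientGroup.mk' M)
    · right
      have := hφ _ (hL.comap _) g₀ hg₀ h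
      rw [← Subgroup.comap_top (QuotientGroup.mk' M)] at this
      exact Subgroup.comap_injective (QuotientGroup.mk'_surjective M) this
    · left
      have hle : L.comap (QuotientGroup.mk' M) ≤ M :=
        hM.2 ⟨hL.comap _, h⟩ (by simpa using Subgroup.ker_le_comap (QuotientGroup.mk' M) L)
      rw [eq_bot_iff]
      intro x hx
      obtain ⟨y, rfl⟩ := QuotientGroup.mk'_surjective M x
      simpa using hle hx
  · rw [injective_iff_map_eq_one]
    intro g hg
    by_contra hne
    have : M = ⊤ := hφ M hMn g hne (by simpa using hg)
    exact hMg (this ▸ Subgroup.mem_top _)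

section

variable (G : Type)

open Classical in
/-- The action of a permutation of `Fin 4` on the fibre over `z`. -/
noncomputable def fiberPerm (z : G × ℤ) : Perm (Fin 4) →* Perm ((G × ℤ) × (Fin 4 × ℕ)) :=
  (onFiber (Fin 4 × ℕ) z).comp (onBase (Fin 4) ℕ)

variable {G} in
lemma fiberPerm_commute {z z' : G × ℤ} (h : z ≠ z') (p q : Perm (Fin 4)) :
    Commute (fiberPerm G z p) (fiberPerm G z' q) := by
  classical
  exact (Pi.mulSingle_commute h _ _).map (fiberwise _ _)

variable [Group G]

/-- The translation of the second coordinate of `G × ℤ`, acting on `(G × ℤ) × (Fin 4 × ℕ)`. -/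
def translation : Perm ((G × ℤ) × (Fin 4 × ℕ)) :=
  onBase (G × ℤ) (Fin 4 × ℕ) (fiberwise G ℤ fun _ => Equiv.addRight 1)

/-- The left translation by `g` of the slices with nonnegative integer coordinate. -/
def halfMul (g : G) : Perm ((G × ℤ) × (Fin 4 × ℕ)) :=
  onBase (G × ℤ) (Fin 4 × ℕ) (slicewise G ℤ fun k => if 0 ≤ k then Equiv.mulLeft g else 1)

/-- The left translation by `g` of the slice with integer coordinate zero. -/
def zeroMul : G →* Perm ((G × ℤ) × (Fin 4 × ℕ)) :=
  ((onBase (G × ℤ) (Fin 4 × ℕ)).comp (slicewise G ℤ)).comp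
    ((MonoidHom.mulSingle (fun _ : ℤ => Perm G) 0).comp (MulAction.toPermHom G G))

variable {G}

lemma zeroMul_eq (g : G) : zeroMul G g = ⁅halfMul G g, translation G⁆ := by
  rw [halfMul, translation, ← map_commutatorElement]
  refine congr_arg (onBase (G × ℤ) (Fin 4 × ℕ)) ?_
  rw [commutatorElement_def, eq_mul_inv_iff_mul_eq, eq_mul_inv_iff_mul_eq]
  ext1 ⟨z, k⟩
  rcases lt_trichotomy k (-1) with h | rfl | h
  · have h1 : ¬ 0 ≤ k := by omega
    have h2 : ¬ 0 ≤ k + 1 := by omega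
    have h3 : k + 1 ≠ 0 := by omega
    simp [h1, h2, h3]
  · simp
  · have h1 : 0 ≤ k := by omega
    have h2 : 0 ≤ k + 1 := by omega
    have h3 : k + 1 ≠ 0 := by omega
    simp [h1, h2, h3]

lemma zeroMul_injective : Function.Injective (zeroMul G) := by
  intro g h e
  have := congr_arg (fun p : Perm ((G × ℤ) × (Fin 4 × ℕ)) => (p ((1, 0), (0, 0))).1.1) e
  simpa [zeroMul] using this

lemma zeroMul_mul_fiberPerm (g : G) (p : Perm (Fin 4)) :
    zeroMul G g * fiberPerm G (1, 0) p = fiberPerm G (g, 0) p * zeroMul G g := by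
  classical
  have := onBase_mul_onFiber (F := Fin 4 × ℕ)
    (slicewise G ℤ (Pi.mulSingle 0 (MulAction.toPermHom G G g))) (1, 0) (onBase (Fin 4) ℕ p)
  simpa [zeroMul, fiberPerm] using this

/-- A three-cycle of `Fin 4` fixing `3`. -/
abbrev cycleA : Perm (Fin 4) := ⁅(swap 0 1 : Perm (Fin 4)), swap 1 2⁆

/-- A three-cycle of `Fin 4` fixing `2`. -/
abbrev cycleB : Perm (Fin 4) := ⁅(swap 0 1 : Perm (Fin 4)), swap 1 3⁆

lemma commutator_cycleA_cycleB : ⁅cycleA⁻¹, cycleB⁆ = swap 0 3 * swap 1 2 := by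
  unfold cycleA cycleB
  simp only [commutatorElement_def]
  decide

lemma fiberPerm_mem_of_zeroMul_mem {K N : Subgroup (Perm ((G × ℤ) × (Fin 4 × ℕ)))}
    (hN : ∀ k ∈ K, ∀ n ∈ N, k * n * k⁻¹ ∈ N) {p q : Perm (Fin 4)}
    (hp : fiberPerm G (1, 0) p ∈ K) (hq : fiberPerm G (1, 0) q ∈ K)
    {g : G} (hg : g ≠ 1) (h : zeroMul G g ∈ N) : fiberPerm G (1, 0) ⁅p⁻¹, q⁆ ∈ N := by
  have h1 : fiberPerm G (g, 0) p * (fiberPerm G (1, 0) p)⁻¹ ∈ N := by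
    rw [← mul_inv_eq_iff_eq_mul.2 (zeroMul_mul_fiberPerm g p)]
    have := mul_mem h (hN _ hp _ (inv_mem h))
    simpa only [mul_assoc] using this
  have h2 := mul_mem h1 (hN _ hq _ (inv_mem h1))
  have hc : ∀ r, Commute (fiberPerm G (g, 0) p) (fiberPerm G (1, 0) r) := fun r =>
    fiberPerm_commute (by simpa using hg) p r
  convert h2 using 1
  rw [map_commutatorElement, map_inv, commutatorElement_def]
  have e := (((hc p).inv_right.mul_right (hc q)).mul_right (hc p)).mul_inv_cancel
  rw [inv_inv, ← e]
  group

end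

theorem exists_two_generated_with_normally_generating_embedding
    (G : Type) [Group G] [Countable G] :
    ∃ (H : Type) (_ : Group H) (u v : H) (φ : G →* H), Subgroup.closure {u, v} = ⊤ ∧
      Function.Injective φ ∧ ∀ N : Subgroup H, N.Normal → ∀ g, g ≠ 1 → φ g ∈ N → N = ⊤ := by
  classical
  obtain ⟨a, ha⟩ : ∃ a : ℕ → Perm ((G × ℤ) × (Fin 4 × ℕ)),
      insert (translation G) (Set.range (halfMul G) ∪ Set.range (fiberPerm G (1, 0))) =
        Set.range a :=
    (((Set.countable_range _).union (Set.countable_range _)).insert _).exists_eq_range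
      (Set.insert_nonempty _ _)
  obtain ⟨w, hwdef⟩ : ∃ w : Perm (Fin 4), w = swap 0 3 * swap 1 2 := ⟨_, rfl⟩
  let s : Perm (ℤ × ((G × ℤ) × (Fin 4 × ℕ))) := onFiber _ 0 (fiberPerm G (1, 0) w)
  let S : Set (ℤ × ((G × ℤ) × (Fin 4 × ℕ))) :=
    {x | x.1 = 0 ∧ x.2.1 = (1, 0) ∧ x.2.2.1 < w x.2.2.1}
  have hs : ∀ x, s x =
      (x.1, x.2.1, if x.1 = 0 ∧ x.2.1 = (1, 0) then w x.2.2.1 else x.2.2.1, x.2.2.2) := by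
    rintro ⟨k, z, i, n⟩
    by_cases h1 : k = 0 <;> by_cases h2 : z = (1, 0) <;>
      simp [s, fiberPerm, onFiber_apply, h1, h2]
  have hw : ∀ i, w (w i) = i := by rw [hwdef]; decide
  have hw0 : 0 < w 0 := by rw [hwdef]; decide
  have hw' : ∀ i, w i ≠ i := by rw [hwdef]; decide
  have h₁ : S.Infinite := by
    refine Set.infinite_of_injective_forall_mem
      (f := fun n : ℕ => ((0 : ℤ), ((1 : G), (0 : ℤ)), ((0 : Fin 4), n))) ?_ ?_
    · intro m n h
      simpa using h
    · intro n
      exact ⟨rfl, rfl, hw0⟩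
  have h₂ : Sᶜ.Infinite := by
    refine Set.infinite_of_injective_forall_mem
      (f := fun n : ℕ => ((1 : ℤ), ((1 : G), (0 : ℤ)), ((0 : Fin 4), n))) ?_ ?_
    · intro m n h
      simpa using h
    · intro n h
      exact one_ne_zero h.1
  obtain ⟨τ, hτ, hτS⟩ := exists_involution_exchanging_compl h₁ h₂
  let σ := lower ((G × ℤ) × (Fin 4 × ℕ))
  let A := fiberwise ℤ _ (sparse a)
  let K := (fiberH σ A τ S).comap (onFiber _ 0)
  let ψ : Perm ((G × ℤ) × (Fin 4 × ℕ)) →* Perm (Fin 15 × (ℤ × ((G × ℤ) × (Fin 4 × ℕ)))) :=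
    (onFiber _ 0).comp (onFiber _ 0)
  have hψ : Function.Injective ψ := (onFiber_injective _).comp (onFiber_injective _)
  have hK : ∀ x ∈ Set.range a, ∀ y ∈ Set.range a, ⁅x, y⁆ ∈ K := by
    rintro _ ⟨m, rfl⟩ _ ⟨n, rfl⟩
    exact onFiber_commutator_mem_fiberH a τ S m n
  rw [← ha] at hK
  have hzero : ∀ g, zeroMul G g ∈ K := fun g => by
    rw [zeroMul_eq]
    exact hK _ (by simp) _ (by simp)
  have hcyc : ∀ p q, fiberPerm G (1, 0) ⁅p, q⁆ ∈ K := fun p q => by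
    rw [map_commutatorElement]
    exact hK _ (by simp) _ (by simp)
  refine ⟨genH σ A τ S, inferInstance, ⟨_, genU_mem σ A τ S⟩, ⟨_, genV_mem σ A τ S⟩,
    (ψ.comp (zeroMul G)).codRestrict _ hzero, ?_, ?_, ?_⟩
  · exact closure_genU_genV σ A τ S
  · exact fun g h e => zeroMul_injective (hψ (congr_arg Subtype.val e))
  · intro N hN g hg hgN
    have hN' : ∀ h ∈ genH σ A τ S, ∀ n ∈ N.map (genH σ A τ S).subtype,
        h * n * h⁻¹ ∈ N.map (genH σ A τ S).subtype := by
      rintro h hh _ ⟨n, hn, rfl⟩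
      exact ⟨⟨h, hh⟩ * n * ⟨h, hh⟩⁻¹, hN.conj_mem n hn _, rfl⟩
    have hsN := fiberPerm_mem_of_zeroMul_mem (K := K)
      (N := (N.map (genH σ A τ S).subtype).comap ψ) (fun k hk n hn => by
        have := hN' _ hk _ hn
        rw [Subgroup.mem_comap, map_mul, map_mul, map_inv]
        exact this) (hcyc (swap 0 1) (swap 1 2)) (hcyc (swap 0 1) (swap 1 3)) hg
      ⟨_, hgN, rfl⟩
    rw [commutator_cycleA_cycleB, ← hwdef] at hsN
    have hle : genH σ A τ S ≤ N.map (genH σ A τ S).subtype := by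
      refine genH_le hN' hτ hτS (s := s) ?_ ?_ ?_ hsN
      · rintro ⟨k, z, i, n⟩
        rw [hs, hs]
        by_cases h : k = 0 ∧ z = (1, 0) <;> simp [h, hw]
      · rintro x ⟨h1, h2, h3⟩ hx
        have h4 := hx.2.2
        rw [hs, if_pos ⟨h1, h2⟩] at h4
        exact h3.not_gt (by simpa only [hw] using h4)
      · intro x hx hx'
        rw [hs] at hx' ⊢
        by_cases h : x.1 = 0 ∧ x.2.1 = (1, 0)
        · rw [if_pos h] at hx'
          rcases lt_or_gt_of_ne (hw' x.2.2.1) with h' | h'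
          · exact absurd ⟨h.1, h.2, by simpa only [hw] using h'⟩ hx'
          · exact absurd ⟨h.1, h.2, h'⟩ hx
        · rw [if_neg h]
    rw [eq_top_iff]
    rintro x -
    obtain ⟨n, hn, e⟩ := hle x.2
    exact (Subtype.ext e : n = x) ▸ hn

/-- Goryushkin: every countable group embeds into a 2-generated simple group. -/
theorem goryushkin_embedding_into_two_generated_simple_group
    (G : Type) [Group G] [Countable G] :
    ∃ (S : Type) (_ : Group S),
      IsSimpleGroup S ∧
      (∃ s t : S, Subgroup.closure {s, t} = ⊤) ∧
      ∃ φ : G →* S, Function.Injective φ := by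
  obtain ⟨H, _, u, v, φ, huv, hinj, hφ⟩ :=
    exists_two_generated_with_normally_generating_embedding (G × Perm (Fin 2))
  obtain ⟨M, _, hM, hMφ⟩ := exists_simple_quotient hφ hinj
  refine ⟨H ⧸ M, inferInstance, hM, ⟨QuotientGroup.mk' M u, QuotientGroup.mk' M v, ?_⟩,
    ((QuotientGroup.mk' M).comp φ).comp (MonoidHom.inl G (Perm (Fin 2))),
    hMφ.comp fun g h e => congr_arg Prod.fst e⟩
  rw [← Set.image_pair, ← MonoidHom.map_closure, huv, ← MonoidHom.range_eq_map,
    MonoidHom.range_eq_top]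
  exact QuotientGroup.mk'_surjective M
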